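/- Let q be a prime power with q ≡ 5 (mod 8) and let e be an arbitrary positive integer. Then there exists a skew Hadamard matrix of order 2(q^e + 1). -/

import Mathlib

open Matrix

/-- The power of `I` spanning the lower boundary of the half-open quadrant that contains `z`. -/
noncomputable def quadrant (z : ℂ) : ℂ :=
  if 0 < z.re ∧ 0 ≤ z.im then 1
  else if z.re ≤ 0 ∧ 0 < z.im then Complex.I
  else if z.re < 0 ∧ z.im ≤ 0 then -1
  else if 0 ≤ z.re ∧ z.im < 0 then -Complex.I
  else 0

lemma quadrant_I_mul (z : ℂ) : quadrant (Complex.I * z) = Complex.I * quadrant z := by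
  simp only [quadrant, Complex.mul_re, Complex.mul_im, Complex.I_re, Complex.I_im]
  rcases lt_trichotomy z.re 0 with h | h | h <;> rcases lt_trichotomy z.im 0 with h' | h' | h' <;>
    simp [h, h', h.le, h'.le, h.not_gt, h'.not_gt]

lemma quadrant_neg (z : ℂ) : quadrant (-z) = -quadrant z := by
  have h : -z = Complex.I * (Complex.I * z) := by
    rw [← mul_assoc, Complex.I_mul_I, neg_one_mul]
  rw [h, quadrant_I_mul, quadrant_I_mul, ← mul_assoc, Complex.I_mul_I, neg_one_mul]

lemma eq_of_pow_four_eq_one {u : ℂ} (hu : u ^ 4 = 1) :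
    u = 1 ∨ u = -1 ∨ u = Complex.I ∨ u = -Complex.I := by
  have h : (u - 1) * ((u + 1) * ((u - Complex.I) * (u + Complex.I))) = 0 := by
    linear_combination hu + (-u ^ 2 + 1) * Complex.I_sq
  simpa [sub_eq_zero, add_eq_zero_iff_eq_neg] using h

lemma quadrant_mul_of_pow_four_eq_one {u : ℂ} (hu : u ^ 4 = 1) (z : ℂ) :
    quadrant (u * z) = u * quadrant z := by
  rcases eq_of_pow_four_eq_one hu with rfl | rfl | rfl | rfl <;>
    simp [quadrant_neg, quadrant_I_mul]

lemma quadrant_pow_four {z : ℂ} (hz : z ≠ 0) : quadrant z ^ 4 = 1 := by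
  have hz' : z.re ≠ 0 ∨ z.im ≠ 0 := by
    contrapose! hz
    exact Complex.ext hz.1 hz.2
  have hI : Complex.I ^ 4 = 1 := Complex.I_pow_four
  have hI' : (-Complex.I) ^ 4 = 1 := by rw [neg_pow, hI]; norm_num
  unfold quadrant
  split_ifs with h₁ h₂ h₃ h₄
  · simp
  · exact hI
  · norm_num
  · exact hI'
  · exfalso
    rcases lt_trichotomy z.re 0 with h | h | h <;> rcases lt_trichotomy z.im 0 with h' | h' | h' <;>
      grind

/-- A function with zero sum and flat nontrivial Fourier spectrum has two-valued autocorrelation. -/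
lemma sum_mul_star_translate {F : Type*} [Field F] [Fintype F] [DecidableEq F]
    {ψ : AddChar F ℂ} (hψ : ψ.IsPrimitive) {φ : F → ℂ} (h₀ : ∑ x, φ x = 0)
    (hφ : ∀ y ≠ 0, (∑ x, φ x * ψ (x * y)) * star (∑ x, φ x * ψ (x * y)) = Fintype.card F)
    (d : F) :
    ∑ x, φ x * star (φ (x + d)) = (if d = 0 then (Fintype.card F : ℂ) else 0) - 1 := by
  have hQ : (Fintype.card F : ℂ) ≠ 0 := by simp
  have hstar (x : F) : star (ψ x) = ψ (-x) := by
    rw [AddChar.map_neg_eq_conj]; rfl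
  have expand (y : F) : (∑ x, φ x * ψ (x * y)) * star (∑ x, φ x * ψ (x * y)) * ψ (y * d) =
      ∑ x, ∑ z, φ x * star (φ z) * ψ (y * (x - z + d)) := by
    rw [star_sum, Finset.sum_mul_sum, Finset.sum_mul]
    refine Finset.sum_congr rfl fun x _ ↦ ?_
    rw [Finset.sum_mul]
    refine Finset.sum_congr rfl fun z _ ↦ ?_
    have : y * (x - z + d) = x * y + -(z * y) + y * d := by ring
    rw [this, AddChar.map_add_eq_mul, AddChar.map_add_eq_mul, star_mul', hstar]
    ring
  have left : ∑ y, (∑ x, φ x * ψ (x * y)) * star (∑ x, φ x * ψ (x * y)) * ψ (y * d) =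
      Fintype.card F * ∑ x, φ x * star (φ (x + d)) := by
    simp_rw [expand]
    rw [Finset.sum_comm, Finset.mul_sum]
    refine Finset.sum_congr rfl fun x _ ↦ ?_
    rw [Finset.sum_comm]
    simp_rw [← Finset.mul_sum, AddChar.sum_mulShift _ hψ]
    rw [Finset.sum_eq_single (x + d)]
    · simp; ring
    · intro z _ hz
      have : x - z + d ≠ 0 := fun h ↦ hz (by linear_combination -h)
      simp [this]
    · simp
  have right (y : F) : (∑ x, φ x * ψ (x * y)) * star (∑ x, φ x * ψ (x * y)) * ψ (y * d) =
      Fintype.card F * ψ (y * d) - if y = 0 then (Fintype.card F : ℂ) else 0 := by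
    by_cases hy : y = 0
    · simp [hy, h₀]
    · rw [hφ y hy]; simp [hy]
  apply mul_left_cancel₀ hQ
  rw [← left]
  simp_rw [right]
  rw [Finset.sum_sub_distrib, ← Finset.mul_sum, AddChar.sum_mulShift _ hψ]
  simp [mul_sub]

/-- Doubling a skew complex conference matrix with entries in the fourth roots of unity. -/
lemma exists_skew_hadamard_of_skew_conference {ι : Type*} [Fintype ι] [DecidableEq ι]
    {n : ℕ} {C : Matrix ι ι ℂ} (hskew : Cᵀ = -C) (hunit : ∀ i j, i ≠ j → C i j ^ 4 = 1)
    (hC : C * Cᴴ = (n : ℂ) • 1) :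
    ∃ H : Matrix (ι ⊕ ι) (ι ⊕ ι) ℝ, (∀ i j, H i j = 1 ∨ H i j = -1) ∧
      H * Hᵀ = ((2 * (n + 1) : ℕ) : ℝ) • 1 ∧ (H - 1)ᵀ = -(H - 1) := by
  set P : Matrix ι ι ℝ := C.map Complex.re with hP
  set R : Matrix ι ι ℝ := C.map Complex.im with hR
  have hskew' (i j : ι) : C j i = -C i j := congrFun₂ hskew i j
  have hPt : Pᵀ = -P := by ext i j; simp [hP, hskew' i j]
  have hRt : Rᵀ = -R := by ext i j; simp [hR, hskew' i j]
  have hdiag (i : ι) : C i i = 0 := self_eq_neg.mp (hskew' i i)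
  have hre : P * P + R * R = -((n : ℝ) • 1) := by
    have h : P * Pᵀ + R * Rᵀ = (n : ℝ) • 1 := by
      ext i j
      have := congrArg Complex.re (congrFun₂ hC i j)
      simp only [mul_apply, conjTranspose_apply, Complex.re_sum] at this
      simp only [Matrix.add_apply, mul_apply, ← Finset.sum_add_distrib]
      by_cases hij : i = j <;> simpa [hP, hR, hij] using this
    rw [hPt, hRt, mul_neg, mul_neg, ← neg_add] at h
    rw [← h, neg_neg]
  have him : R * P = P * R := by
    have h : R * Pᵀ - P * Rᵀ = 0 := by
      ext i j
      have := congrArg Complex.im (congrFun₂ hC i j)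
      simp only [mul_apply, conjTranspose_apply, Complex.im_sum] at this
      simp only [Matrix.sub_apply, mul_apply, ← Finset.sum_sub_distrib]
      have h' : ((n : ℂ) • (1 : Matrix ι ι ℂ)) i j = if i = j then (n : ℂ) else 0 := by
        simp [one_apply]
      rw [h', show (if i = j then (n : ℂ) else 0).im = 0 by split_ifs <;> simp] at this
      rw [Matrix.zero_apply, ← this]
      refine Finset.sum_congr rfl fun k _ ↦ ?_
      simp [hP, hR]; ring
    rw [hPt, hRt, mul_neg, mul_neg, sub_neg_eq_add, neg_add_eq_zero] at h
    exact h
  have sign (i j : ι) (hij : i ≠ j) :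
      (P i j + R i j = 1 ∨ P i j + R i j = -1) ∧ (P i j - R i j = 1 ∨ P i j - R i j = -1) := by
    rcases eq_of_pow_four_eq_one (hunit i j hij) with h | h | h | h <;> simp [hP, hR, h]
  refine ⟨fromBlocks (1 + (P + R)) (1 + (P - R)) ((P - R) - 1) (1 - (P + R)), ?_, ?_, ?_⟩
  · rintro (i | i) (j | j) <;> by_cases hij : i = j
    all_goals first
      | subst hij; simp [hP, hR, hdiag]
      | have := sign i j hij
        simp only [fromBlocks_apply₁₁, fromBlocks_apply₁₂, fromBlocks_apply₂₁, fromBlocks_apply₂₂,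
          Matrix.add_apply, Matrix.sub_apply, one_apply_ne hij, zero_add, sub_zero, zero_sub]
        grind
  · rw [fromBlocks_transpose, fromBlocks_multiply, ← fromBlocks_one, fromBlocks_smul]
    simp only [transpose_add, transpose_sub, transpose_one, hPt, hRt, smul_zero]
    have hn : ((2 * (n + 1) : ℕ) : ℝ) • (1 : Matrix ι ι ℝ) =
        1 + 1 - ((P * P + R * R) + (P * P + R * R)) := by
      rw [hre]
      push_cast
      module
    rw [hn, fromBlocks_inj]
    refine ⟨?_, ?_, ?_, ?_⟩
    · noncomm_ring
    · noncomm_ring [him]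
    · noncomm_ring [him]
    · noncomm_ring
  · have h1 : (1 : Matrix (ι ⊕ ι) (ι ⊕ ι) ℝ) = fromBlocks 1 0 0 1 := fromBlocks_one.symm
    rw [h1, sub_eq_add_neg, fromBlocks_neg, fromBlocks_add, fromBlocks_transpose, fromBlocks_neg,
      fromBlocks_inj]
    simp only [transpose_add, transpose_sub, transpose_neg, transpose_one, transpose_zero, hPt, hRt]
    refine ⟨?_, ?_, ?_, ?_⟩ <;> abel

lemma sum_eq_zero_of_odd {F : Type*} [AddCommGroup F] [Fintype F] {φ : F → ℂ}
    (hodd : ∀ x, φ (-x) = -φ x) : ∑ x, φ x = 0 := by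
  rw [← self_eq_neg, ← Finset.sum_neg_distrib]
  simp_rw [← hodd]
  exact (Equiv.sum_comp (Equiv.neg F) φ).symm

/-- Bordering the convolution matrix of an odd function with two-valued autocorrelation gives a
skew complex conference matrix. -/
lemma exists_skew_conference_of_autocorrelation {F : Type*} [AddCommGroup F] [Fintype F]
    [DecidableEq F] {φ : F → ℂ} (hodd : ∀ x, φ (-x) = -φ x) (hunit : ∀ x ≠ 0, φ x ^ 4 = 1)
    (hφ : ∀ d, ∑ x, φ x * star (φ (x + d)) = (if d = 0 then (Fintype.card F : ℂ) else 0) - 1) :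
    ∃ C : Matrix (Option F) (Option F) ℂ, Cᵀ = -C ∧ (∀ i j, i ≠ j → C i j ^ 4 = 1) ∧
      C * Cᴴ = (Fintype.card F : ℂ) • 1 := by
  have hsum' (x : F) : ∑ y, φ (x - y) = 0 :=
    (Equiv.sum_comp (Equiv.subLeft x) φ).trans (sum_eq_zero_of_odd hodd)
  have hcorr (x y : F) : ∑ z, φ (x - z) * star (φ (y - z)) =
      (if x = y then (Fintype.card F : ℂ) else 0) - 1 := by
    have h := Equiv.sum_comp (Equiv.subLeft x) fun z ↦ φ z * star (φ (z + (y - x)))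
    simp only [Equiv.subLeft_apply, hφ, sub_eq_zero, eq_comm (a := y)] at h
    rw [← h]
    refine Finset.sum_congr rfl fun z _ ↦ ?_
    rw [show x - z + (y - x) = y - z by abel]
  let C : Matrix (Option F) (Option F) ℂ := fun i j ↦ match i, j with
    | none, none => 0
    | none, some _ => 1
    | some _, none => -1
    | some x, some y => φ (x - y)
  have h₀₀ : C none none = 0 := rfl
  have h₀₁ (x : F) : C none (some x) = 1 := rfl
  have h₁₀ (x : F) : C (some x) none = -1 := rfl
  have h₁₁ (x y : F) : C (some x) (some y) = φ (x - y) := rfl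
  clear_value C
  refine ⟨C, ?_, ?_, ?_⟩
  · ext (_ | x) (_ | y) <;> simp [h₀₀, h₀₁, h₁₀, h₁₁, ← hodd]
  · rintro (_ | x) (_ | y) h
    · exact absurd rfl h
    · simp [h₀₁]
    · norm_num [h₁₀]
    · rw [h₁₁]
      exact hunit _ (sub_ne_zero.mpr fun hxy ↦ h (congrArg some hxy))
  · ext (_ | x) (_ | y)
    · simp [h₀₀, h₀₁, mul_apply, Fintype.sum_option]
    · simp [h₀₀, h₀₁, h₁₁, mul_apply, Fintype.sum_option, ← map_sum, hsum']
    · simp [h₀₀, h₀₁, h₁₁, mul_apply, Fintype.sum_option, hsum']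
    · simp only [mul_apply, Fintype.sum_option, conjTranspose_apply, h₁₀, h₁₁, hcorr x y]
      by_cases hxy : x = y <;> simp [hxy]

lemma exists_pow_two_pow_eq {q : ℕ} (hq : q % 8 = 5) (s : ℕ) :
    ∃ c, q ^ 2 ^ s = 1 + 2 ^ (s + 2) * (2 * c + 1) := by
  induction s with
  | zero => exact ⟨q / 8, by simp; omega⟩
  | succ s ih =>
    obtain ⟨c, hc⟩ := ih
    refine ⟨c + 2 ^ s * (2 * c + 1) ^ 2, ?_⟩
    rw [pow_succ 2 s, pow_mul, hc]
    ring

/-- A finite field carries a primitive additive character invariant under Frobenius. -/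
lemma exists_primitive_addChar_pow_char (F : Type*) [Field F] [Finite F] (p : ℕ) [Fact p.Prime]
    [CharP F p] : ∃ ψ : AddChar F ℂ, ψ.IsPrimitive ∧ ∀ n x, ψ (x ^ p ^ n) = ψ x := by
  let : Algebra (ZMod p) F := ZMod.algebra F p
  let ψ : AddChar F ℂ :=
    (ZMod.stdAddChar (N := p)).compAddMonoidHom (Algebra.trace (ZMod p) F).toAddMonoidHom
  have hψ (x : F) : ψ x = ZMod.stdAddChar (Algebra.trace (ZMod p) F x) := rfl
  refine ⟨ψ, AddChar.IsPrimitive.of_ne_one fun h ↦ ?_, fun n x ↦ ?_⟩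
  · obtain ⟨x, hx⟩ := Algebra.trace_surjective (ZMod p) F 1
    have h' := hψ x
    rw [h, hx, AddChar.one_apply, ← AddChar.map_zero_eq_one (ZMod.stdAddChar (N := p))] at h'
    exact zero_ne_one (ZMod.injective_stdAddChar h')
  · induction n with
    | zero => simp
    | succ n ih =>
      rw [pow_succ, pow_mul, ← ih, hψ, hψ,
        ← Algebra.trace_eq_of_algEquiv (FiniteField.frobeniusAlgEquiv (ZMod p) F p) (x ^ p ^ n)]
      simp

/-- A finite field of odd order carries an odd multiplicative character of 2-power order. -/
lemma exists_odd_mulChar_two_pow (F : Type*) [Field F] [Fintype F] (hF : Odd (Fintype.card F)) :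
    ∃ (θ : MulChar F ℂ) (m : ℕ), θ (-1) = -1 ∧ θ ^ 2 ^ (m + 2) = 1 := by
  have hcard : Fintype.card F - 1 ≠ 0 := by
    have := Fintype.one_lt_card (α := F); omega
  obtain ⟨m, k, hk, hmk⟩ := Nat.exists_eq_two_pow_mul_odd hcard
  obtain ⟨r, rfl⟩ : ∃ r, m = r + 1 := by
    refine Nat.exists_eq_succ_of_ne_zero fun hm ↦ ?_
    rw [hm, pow_zero, one_mul] at hmk
    grind
  obtain ⟨θ, hθ⟩ := MulChar.exists_mulChar_orderOf F (R := ℂ) (n := 2 ^ (r + 1))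
    (Dvd.intro _ hmk.symm) (Complex.isPrimitiveRoot_exp _ (by positivity))
  refine ⟨θ, r, ?_, orderOf_dvd_iff_pow_eq_one.mp (hθ ▸ pow_dvd_pow 2 (by omega))⟩
  have hsq : θ (-1) ^ 2 = 1 := by rw [← map_pow, neg_one_sq, map_one]
  refine (sq_eq_one_iff.mp hsq).resolve_left fun h ↦ ?_
  have hpow : θ ^ 2 ^ r = 1 := by
    ext x
    rw [MulChar.pow_apply_coe, MulChar.one_apply_coe]
    have hw : (θ x ^ 2 ^ r) ^ 2 = 1 := by
      rw [← pow_mul, ← pow_succ, ← MulChar.pow_apply_coe, ← hθ, pow_orderOf_eq_one,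
        MulChar.one_apply_coe]
    have hx : ((x : F) ^ (2 ^ r * k)) ^ 2 = 1 := by
      rw [← pow_mul, mul_right_comm, ← pow_succ, ← hmk]
      exact FiniteField.pow_card_sub_one_eq_one _ x.ne_zero
    have hθx : (θ x ^ 2 ^ r) ^ k = 1 := by
      rw [← pow_mul, ← map_pow]
      rcases sq_eq_one_iff.mp hx with h' | h' <;> simp [h', h]
    obtain ⟨l, rfl⟩ := hk
    rwa [pow_succ, pow_mul, hw, one_pow, one_mul] at hθx
  have := orderOf_dvd_iff_pow_eq_one.mpr hpow
  rw [hθ, Nat.pow_dvd_pow_iff_le_right (by norm_num)] at this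
  omega

/-- Frobenius invariance of `ψ` concentrates the sum of an odd function of `θ` on the elements
where `θ` is a fourth root of unity. -/
lemma sum_eq_sum_filter_pow_four {F : Type*} [Field F] [Fintype F] {p t : ℕ} [Fact p.Prime]
    [CharP F p] (hpt : p ^ t % 8 = 5) {ψ : AddChar F ℂ} (hψ : ∀ n x, ψ (x ^ p ^ n) = ψ x)
    {θ : MulChar F ℂ} {m : ℕ} (hθ : θ ^ 2 ^ (m + 2) = 1) {f : ℂ → ℂ}
    (hf : ∀ z, f (-z) = -f z) :
    ∑ x, f (θ x) * ψ x = ∑ x with θ x ^ 4 = 1, f (θ x) * ψ x := by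
  classical
  have hf₀ : f 0 = 0 := by simpa [self_eq_neg] using hf 0
  have step (r : ℕ) : ∑ x with θ x ^ 2 ^ (r + 2) = -1, f (θ x) * ψ x = 0 := by
    obtain ⟨c, hc⟩ := exists_pow_two_pow_eq hpt r
    rw [← pow_mul] at hc
    have hpow (x : F) (hx : θ x ^ 2 ^ (r + 2) = -1) :
        θ (iterateFrobenius F p (t * 2 ^ r) x) = -θ x := by
      rw [iterateFrobenius_def, map_pow, hc, pow_add, pow_mul, hx, pow_one,
        Odd.neg_one_pow ⟨c, rfl⟩, mul_neg_one]
    have himage : (Finset.univ.filter fun x ↦ θ x ^ 2 ^ (r + 2) = -1).image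
        (iterateFrobenius F p (t * 2 ^ r)) =
        Finset.univ.filter fun x ↦ θ x ^ 2 ^ (r + 2) = -1 := by
      refine Finset.eq_of_subset_of_card_le ?_
        (Finset.card_image_of_injective _ (iterateFrobenius F p (t * 2 ^ r)).injective).ge
      rw [Finset.image_subset_iff]
      intro x hx
      rw [Finset.mem_filter] at hx ⊢
      refine ⟨Finset.mem_univ _, ?_⟩
      rw [hpow x hx.2, Even.neg_pow ⟨2 ^ (r + 1), by ring⟩, hx.2]
    rw [← self_eq_neg, ← Finset.sum_neg_distrib]
    nth_rw 1 [← himage]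
    rw [Finset.sum_image (iterateFrobenius F p (t * 2 ^ r)).injective.injOn]
    refine Finset.sum_congr rfl fun x hx ↦ ?_
    rw [hpow x (Finset.mem_filter.mp hx).2, iterateFrobenius_def, hψ, hf, neg_mul]
  have hfilter (r : ℕ) : ∑ x with θ x ^ 2 ^ (r + 2) = 1, f (θ x) * ψ x =
      ∑ x with θ x ^ 4 = 1, f (θ x) * ψ x := by
    induction r with
    | zero => norm_num
    | succ r ih =>
      have hsplit : ∀ x, θ x ^ 2 ^ (r + 1 + 2) = 1 ↔
          θ x ^ 2 ^ (r + 2) = 1 ∨ θ x ^ 2 ^ (r + 2) = -1 := fun x ↦ by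
        rw [show r + 1 + 2 = (r + 2) + 1 by ring, pow_succ 2 (r + 2), pow_mul, sq_eq_one_iff]
      simp_rw [hsplit]
      rw [Finset.filter_or, Finset.sum_union, ih, step, add_zero]
      refine Finset.disjoint_filter.mpr fun x _ h h' ↦ ?_
      rw [h] at h'
      norm_num at h'
  rw [← hfilter m]
  symm
  refine Finset.sum_subset (Finset.filter_subset _ _) fun x _ hx ↦ ?_
  have hx₀ : x = 0 := by
    by_contra h
    refine hx (Finset.mem_filter.mpr ⟨Finset.mem_univ _, ?_⟩)
    rw [← MulChar.pow_apply' θ (by positivity), hθ, MulChar.one_apply (Ne.isUnit h)]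
  rw [hx₀, MulChar.map_zero, hf₀, zero_mul]

/-- The quadrant of an odd character of 2-power order has two-valued autocorrelation, because its
Fourier transform is a unimodular multiple of a Gauss sum. -/
lemma exists_odd_two_valued_autocorrelation {F : Type*} [Field F] [Fintype F] [DecidableEq F]
    {p t : ℕ}
    [Fact p.Prime] [CharP F p] (hpt : p ^ t % 8 = 5) (hF : Odd (Fintype.card F)) :
    ∃ φ : F → ℂ, (∀ x, φ (-x) = -φ x) ∧ (∀ x ≠ 0, φ x ^ 4 = 1) ∧
      ∀ d, ∑ x, φ x * star (φ (x + d)) = (if d = 0 then (Fintype.card F : ℂ) else 0) - 1 := by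
  obtain ⟨ψ, hψ, hψp⟩ := exists_primitive_addChar_pow_char F p
  obtain ⟨θ, m, hθ, hθm⟩ := exists_odd_mulChar_two_pow F hF
  have hθ₁ : θ ≠ 1 := by
    rintro rfl
    rw [MulChar.one_apply isUnit_one.neg] at hθ
    norm_num at hθ
  have hodd (x : F) : quadrant (θ (-x)) = -quadrant (θ x) := by
    rw [← neg_one_mul x, map_mul, hθ, neg_one_mul, quadrant_neg]
  have hunit (x : F) (hx : x ≠ 0) : quadrant (θ x) ^ 4 = 1 :=
    quadrant_pow_four (hx.isUnit.map θ).ne_zero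
  have hfourier (y : F) (hy : y ≠ 0) : ∑ x, quadrant (θ x) * ψ (x * y) =
      quadrant (θ y⁻¹) * gaussSum θ ψ := by
    rw [gaussSum, sum_eq_sum_filter_pow_four hpt hψp hθm (f := fun z ↦ z) fun _ ↦ rfl,
      ← Equiv.sum_comp (Equiv.mulRight₀ y⁻¹ (inv_ne_zero hy)), Finset.mul_sum]
    simp only [Equiv.mulRight₀_apply, map_mul, inv_mul_cancel_right₀ hy]
    rw [sum_eq_sum_filter_pow_four hpt hψp hθm (f := fun z ↦ quadrant (z * θ y⁻¹))
      fun z ↦ by rw [neg_mul, quadrant_neg]]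
    refine Finset.sum_congr rfl fun x hx ↦ ?_
    rw [quadrant_mul_of_pow_four_eq_one (Finset.mem_filter.mp hx).2]
    ring
  refine ⟨fun x ↦ quadrant (θ x), hodd, hunit, sum_mul_star_translate hψ
    (sum_eq_zero_of_odd hodd) fun y hy ↦ ?_⟩
  rw [hfourier y hy, star_mul', mul_mul_mul_comm, star_gaussSum_eq,
    gaussSum_mul_gaussSum_eq_card hθ₁ hψ]
  rcases eq_of_pow_four_eq_one (hunit _ (inv_ne_zero hy)) with h | h | h | h <;> simp [h]

/-- If `q ≡ 5 (mod 8)` is a prime power and `e ≥ 1`, then there exists a skew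
Hadamard matrix of order `2(q^e + 1)`: a `±1`-matrix `H` with
`H Hᵀ = n I` and `H = A + I` where `Aᵀ = -A`. -/
theorem skew_hadamard_matrix_of_order_two_qe_add_one
    (q : ℕ) (hq : IsPrimePow q) (hmod : q % 8 = 5) (e : ℕ) (he : 0 < e) :
    ∃ H : Matrix (Fin (2 * (q ^ e + 1))) (Fin (2 * (q ^ e + 1))) ℝ,
      (∀ i j, H i j = 1 ∨ H i j = -1) ∧
      H * Hᵀ = ((2 * (q ^ e + 1) : ℕ) : ℝ) • 1 ∧
      (H - 1)ᵀ = -(H - 1) := by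
  classical
  obtain ⟨p, t, hp, ht, rfl⟩ := (isPrimePow_nat_iff q).mp hq
  have : Fact p.Prime := ⟨hp⟩
  let F := GaloisField p (t * e)
  have : Fintype F := Fintype.ofFinite F
  have hF : Fintype.card F = (p ^ t) ^ e := by
    rw [← Nat.card_eq_fintype_card, GaloisField.card p _ (by positivity), pow_mul]
  have hFodd : Odd (Fintype.card F) := by
    rw [hF]; exact Odd.pow (Nat.odd_iff.mpr (by omega))
  obtain ⟨φ, hodd, hunit, hφ⟩ := exists_odd_two_valued_autocorrelation (F := F) hmod hFodd
  obtain ⟨C, hskew, hCunit, hC⟩ := exists_skew_conference_of_autocorrelation hodd hunit hφ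
  obtain ⟨H, hH, hHH, hHskew⟩ := exists_skew_hadamard_of_skew_conference hskew hCunit hC
  rw [hF] at hHH
  let E : Option F ⊕ Option F ≃ Fin (2 * ((p ^ t) ^ e + 1)) :=
    Fintype.equivFinOfCardEq (by simp [hF]; ring)
  refine ⟨H.submatrix E.symm E.symm, fun i j ↦ hH _ _, ?_, ?_⟩
  · rw [transpose_submatrix, submatrix_mul_equiv, hHH]
    ext i j
    simp [one_apply]
  · ext i j
    simpa [one_apply] using congrFun₂ hHskew (E.symm i) (E.symm j)
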